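/- For all sufficiently large t and every m with t ≤ m ≤ 2^{t/16}, letting i_k denote the number of independent sets of size k in T_{m,t,1}, one has i_{mt+2}^2 < i_{mt+1}·i_{mt+3}; that is, log-concavity of the independent set sequence of T_{m,t,1} is broken at mt+2. -/

import Mathlib

open Classical Finset

/-- Vertex set of the tree `T_{m,t,1}`: the root is `none`, the child `w_i` of the
root is `some (Sum.inl i)`, the vertex `x_i^j` is `some (Sum.inr (i, j, 0))` and
its child `y_i^j` is `some (Sum.inr (i, j, 1))`. -/
abbrev TV (m t : ℕ) := Option (Fin m ⊕ Fin m × Fin t × Fin 2)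

/-- The tree `T_{m,t,1}`: the root has `m` children `w_i`, each `w_i` has `t`
children `x_i^j`, and each `x_i^j` has one child `y_i^j`. -/
def treeT (m t : ℕ) : SimpleGraph (TV m t) :=
  SimpleGraph.fromRel (fun a b =>
    (a = none ∧ ∃ i, b = some (Sum.inl i)) ∨
    (∃ i j, a = some (Sum.inl i) ∧ b = some (Sum.inr (i, j, 0))) ∨
    (∃ i j, a = some (Sum.inr (i, j, 0)) ∧ b = some (Sum.inr (i, j, 1))))

/-- The number of independent sets of size `k` in `G`. -/
noncomputable def indepCount {V : Type*} [Fintype V] (G : SimpleGraph V) (k : ℕ) : ℕ :=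
  (Finset.univ.filter (fun s : Finset V =>
    s.card = k ∧ ∀ u ∈ s, ∀ w ∈ s, ¬ G.Adj u w)).card

lemma indep_iff (m t : ℕ) (s : Finset (TV m t)) :
    (∀ u ∈ s, ∀ w ∈ s, ¬ (treeT m t).Adj u w) ↔
      (none ∈ s → ∀ i, some (Sum.inl i) ∉ s) ∧
      (∀ i, some (Sum.inl i) ∈ s → ∀ j, some (Sum.inr (i, j, 0)) ∉ s) ∧
      (∀ i j, some (Sum.inr (i, j, 0)) ∈ s → some (Sum.inr (i, j, 1)) ∉ s) := by
  unfold treeT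
  simp only [SimpleGraph.fromRel_adj]
  constructor
  · intro h
    refine ⟨fun h1 i h2 => h _ h1 _ h2 ⟨by simp, Or.inl (Or.inl ⟨rfl, i, rfl⟩)⟩,
      fun i h1 j h2 => h _ h1 _ h2 ⟨by simp, Or.inl (Or.inr (Or.inl ⟨i, j, rfl, rfl⟩))⟩,
      fun i j h1 h2 => h _ h1 _ h2 ⟨by simp, Or.inl (Or.inr (Or.inr ⟨i, j, rfl, rfl⟩))⟩⟩
  · rintro ⟨h1, h2, h3⟩ u hu w hw ⟨-, h | h⟩
    · rcases h with ⟨rfl, i, rfl⟩ | ⟨i, j, rfl, rfl⟩ | ⟨i, j, rfl, rfl⟩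
      · exact h1 hu i hw
      · exact h2 i hu j hw
      · exact h3 i j hu hw
    · rcases h with ⟨rfl, i, rfl⟩ | ⟨i, j, rfl, rfl⟩ | ⟨i, j, rfl, rfl⟩
      · exact h1 hw i hu
      · exact h2 i hw j hu
      · exact h3 i j hw hu

/-- The graph of a choice function, plus a set of top vertices. -/
noncomputable def mkSet (m t : ℕ) (B : Finset (Option (Fin m)))
    (f : Fin m → Fin t → Fin 2) : Finset (TV m t) :=
  univ.filter (fun v => match v with
    | none => none ∈ B
    | some (Sum.inl i) => some i ∈ B
    | some (Sum.inr (i, j, k)) => f i j = k)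

lemma mkSet_inj (m t : ℕ) (B : Finset (Option (Fin m))) :
    Function.Injective (mkSet m t B) := by
  intro f g h
  funext i j
  have : some (Sum.inr (i, j, f i j)) ∈ mkSet m t B g := by
    rw [← h]; simp [mkSet]
  simpa [mkSet, eq_comm] using this

lemma card_eq_sum (m t : ℕ) (s : Finset (TV m t)) :
    s.card = (if none ∈ s then 1 else 0) + ((∑ i, if some (Sum.inl i) ∈ s then 1 else 0) +
      ∑ i : Fin m, ∑ j : Fin t, ((if some (Sum.inr (i, j, 0)) ∈ s then 1 else 0) +
        (if some (Sum.inr (i, j, 1)) ∈ s then 1 else 0))) := by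
  have : s.card = ∑ v, if v ∈ s then 1 else 0 := by simp
  rw [this, Fintype.sum_option, Fintype.sum_sum_type, Fintype.sum_prod_type]
  simp only [Fintype.sum_prod_type, Fin.sum_univ_two]

lemma mkSet_card (m t : ℕ) (B : Finset (Option (Fin m))) (f : Fin m → Fin t → Fin 2) :
    (mkSet m t B f).card = B.card + m * t := by
  have hB : B.card = ∑ v, if v ∈ B then 1 else 0 := by simp
  rw [card_eq_sum, hB, Fintype.sum_option]
  have h : ∀ i j, ((if some (Sum.inr (i, j, 0)) ∈ mkSet m t B f then 1 else 0) +
        (if some (Sum.inr (i, j, 1)) ∈ mkSet m t B f then 1 else 0)) = 1 := by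
    intro i j
    simp only [mkSet, mem_filter, mem_univ, true_and]
    generalize f i j = k
    fin_cases k <;> simp
  simp only [h]
  simp [mkSet, add_assoc]

lemma lower1 (m t : ℕ) : 2 ^ (m * t) ≤ indepCount (treeT m t) (m * t + 1) := by
  unfold indepCount
  have : 2 ^ (m * t) = (univ : Finset (Fin m → Fin t → Fin 2)).card := by
    simp [← pow_mul, mul_comm]
  rw [this]
  refine Finset.card_le_card_of_injOn (mkSet m t {none}) ?_ (mkSet_inj m t _).injOn
  intro f _
  simp only [coe_filter, mem_univ, true_and, Set.mem_ofPred_eq]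
  refine ⟨by rw [mkSet_card]; simp [add_comm], ?_⟩
  rw [indep_iff]
  simp +contextual [mkSet]

lemma lower3 (n t : ℕ) : 2 ^ (n * t) ≤ indepCount (treeT (n+3) t) ((n+3) * t + 3) := by
  unfold indepCount
  have : 2 ^ (n * t) = (Fintype.piFinset (fun i : Fin (n+3) =>
      Fintype.piFinset (fun _ : Fin t => if i.val < 3 then {1} else (univ : Finset (Fin 2))))).card := by
    have h2 : 2 % (n + 3) < 3 := lt_of_le_of_lt (Nat.mod_le _ _) (by norm_num)
    simp only [Fintype.card_piFinset, Fin.prod_univ_succ (n := n+2), Fin.prod_univ_succ (n := n+1),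
      Fin.prod_univ_succ (n := n)]
    have h3 : ∀ k : ℕ, ¬ (k + 1 + 1 + 1 < 3) := by omega
    simp [h2, h3, ← pow_mul, mul_comm]
  rw [this]
  refine Finset.card_le_card_of_injOn (mkSet (n+3) t {some 0, some 1, some 2}) ?_
    (mkSet_inj _ t _).injOn
  intro f hf
  simp only [coe_filter, mem_univ, true_and, Set.mem_ofPred_eq]
  have hf' : ∀ i : Fin (n+3), i.val < 3 → ∀ j, f i j = 1 := by
    intro i hi j
    have := Fintype.mem_piFinset.1 (Fintype.mem_piFinset.1 (Finset.mem_coe.1 hf) i) j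
    simpa [hi] using this
  refine ⟨?_, ?_⟩
  · rw [mkSet_card]
    rw [Finset.card_eq_three.2 ⟨some 0, some 1, some 2, ?_, ?_, ?_, rfl⟩, add_comm]
    all_goals simp [Fin.ext_iff, Fin.val_two, Nat.mod_eq_of_lt]
  · rw [indep_iff]
    refine ⟨by simp [mkSet], ?_, by simp +contextual [mkSet]⟩
    intro i hi j
    have : i.val < 3 := by
      simp [mkSet] at hi
      rcases hi with rfl | rfl | rfl
      · simp
      · simp
      · exact lt_of_le_of_lt (Nat.mod_le 2 (n + 3)) (by norm_num)
    simp [mkSet, hf' i this j]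

/-- allowed local states of an edge -/
def Lst : Bool → Finset (Bool × Bool)
  | true => {(false, false), (false, true)}
  | false => {(false, false), (false, true), (true, false)}

noncomputable def bw (x : ℝ) (b : Bool) : ℝ := if b then x else 1

noncomputable def code (m t : ℕ) (s : Finset (TV m t)) :
    Fin m → (_ : Bool) × (Fin t → Bool × Bool) :=
  fun i => ⟨decide (some (Sum.inl i) ∈ s),
    fun j => (decide (some (Sum.inr (i, j, 0)) ∈ s), decide (some (Sum.inr (i, j, 1)) ∈ s))⟩

lemma none_not_mem (m t : ℕ) (s : Finset (TV m t)) (hc : s.card = m * t + 2)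
    (hs : ∀ u ∈ s, ∀ w ∈ s, ¬ (treeT m t).Adj u w) : none ∉ s := by
  intro h0
  rw [indep_iff] at hs
  obtain ⟨h1, h2, h3⟩ := hs
  rw [card_eq_sum] at hc
  have hb : ∑ i : Fin m, ∑ j : Fin t, ((if some (Sum.inr (i, j, 0)) ∈ s then 1 else 0) +
        (if some (Sum.inr (i, j, 1)) ∈ s then 1 else 0)) ≤ ∑ i : Fin m, ∑ j : Fin t, 1 := by
    refine sum_le_sum fun i _ => sum_le_sum fun j _ => ?_
    have := h3 i j
    split_ifs <;> simp_all
  simp only [sum_const, card_univ, Fintype.card_fin, smul_eq_mul, mul_one] at hb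
  have hw : (∑ i, if some (Sum.inl i) ∈ s then 1 else 0) = 0 := by
    simp [h1 h0]
  rw [hw, if_pos h0] at hc
  omega

set_option maxHeartbeats 1000000 in
lemma upper_gf (m t : ℕ) (x : ℝ) (hx : 0 ≤ x) :
    (indepCount (treeT m t) (m * t + 2) : ℝ) * x ^ (m * t + 2) ≤
      (x * (1 + x) ^ t + (1 + 2 * x) ^ t) ^ m := by
  let S := (Finset.univ.filter (fun s : Finset (TV m t) =>
    s.card = m * t + 2 ∧ ∀ u ∈ s, ∀ w ∈ s, ¬ (treeT m t).Adj u w))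
  have hS : indepCount (treeT m t) (m * t + 2) = S.card := by
    unfold indepCount
    congr 1
    ext s
    simp only [S, mem_filter]
  rw [hS]
  let A : Finset ((_ : Bool) × (Fin t → Bool × Bool)) :=
    univ.sigma (fun b => Fintype.piFinset fun _ => Lst b)
  let W : (_ : Bool) × (Fin t → Bool × Bool) → ℝ :=
    fun c => bw x c.1 * ∏ j, (bw x (c.2 j).1 * bw x (c.2 j).2)
  have hbw : ∀ b, 0 ≤ bw x b := by intro b; unfold bw; split_ifs <;> linarith
  have hW : ∀ c, 0 ≤ W c := fun c =>
    mul_nonneg (hbw _) (prod_nonneg fun j _ => mul_nonneg (hbw _) (hbw _))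
  have hmem : ∀ s ∈ S, none ∉ s := by
    intro s hs
    have := (mem_filter.1 hs).2
    exact none_not_mem m t s this.1 this.2
  have hcode : ∀ s ∈ S, x ^ (m * t + 2) = ∏ i, W (code m t s i) := by
    intro s hs
    have h0 := hmem s hs
    have hc := (mem_filter.1 hs).2.1
    have : x ^ s.card = ∏ v, if v ∈ s then x else 1 := by simp
    rw [← hc, this, Fintype.prod_option, Fintype.prod_sum_type, Fintype.prod_prod_type]
    simp only [Fintype.prod_prod_type, Fin.prod_univ_two, if_neg h0, one_mul]
    simp only [W, code, bw, decide_eq_true_eq, prod_mul_distrib]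
  have hinj : Set.InjOn (code m t) S := by
    intro s hs s' hs' h
    have h0 := hmem s hs
    have h0' := hmem s' hs'
    ext v
    rcases v with _ | i | ⟨i, j, k⟩
    · simp [h0, h0']
    · have := congrArg Sigma.fst (congrFun h i)
      simpa [code] using this
    · have := congrFun h i
      simp only [code, Sigma.mk.injEq, heq_eq_eq] at this
      have := congrFun this.2 j
      simp only [Prod.mk.injEq, decide_eq_decide] at this
      fin_cases k
      · exact this.1
      · exact this.2
  have hmaps : S.image (code m t) ⊆ Fintype.piFinset (fun _ : Fin m => A) := by
    intro c hc
    obtain ⟨s, hs, rfl⟩ := mem_image.1 hc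
    have hi := (mem_filter.1 hs).2.2
    rw [indep_iff] at hi
    obtain ⟨-, h2, h3⟩ := hi
    rw [Fintype.mem_piFinset]
    intro i
    simp only [A, mem_sigma, mem_univ, true_and, Fintype.mem_piFinset]
    intro j
    have h2 := h2 i
    have h3 := h3 i j
    simp only [code]
    by_cases hw : some (Sum.inl i) ∈ s
    · have := h2 hw j
      by_cases hy : some (Sum.inr (i, j, 1)) ∈ s <;> simp [hw, this, hy, Lst]
    · by_cases hxx : some (Sum.inr (i, j, 0)) ∈ s
      · simp [hw, hxx, h3 hxx, Lst]
      · by_cases hy : some (Sum.inr (i, j, 1)) ∈ s <;> simp [hw, hxx, hy, Lst]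
  have hA : ∑ c ∈ A, W c = x * (1 + x) ^ t + (1 + 2 * x) ^ t := by
    simp only [A, W, sum_sigma, Fintype.sum_bool, ← mul_sum]
    have hp : ∀ b, ∑ g ∈ Fintype.piFinset (fun _ : Fin t => Lst b),
        ∏ j, (bw x (g j).1 * bw x (g j).2) = (∑ p ∈ Lst b, bw x p.1 * bw x p.2) ^ t := by
      intro b
      rw [← Finset.prod_univ_sum (fun _ : Fin t => Lst b) (fun _ p => bw x p.1 * bw x p.2)]
      simp
    rw [hp, hp]
    simp [Lst, bw]
    ring
  calc (S.card : ℝ) * x ^ (m * t + 2) = ∑ s ∈ S, x ^ (m * t + 2) := by simp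
    _ = ∑ s ∈ S, ∏ i, W (code m t s i) := sum_congr rfl hcode
    _ = ∑ c ∈ S.image (code m t), ∏ i, W (c i) := by
        rw [sum_image (f := fun c => ∏ i, W (c i)) hinj]
    _ ≤ ∑ c ∈ Fintype.piFinset (fun _ : Fin m => A), ∏ i, W (c i) :=
        sum_le_sum_of_subset_of_nonneg hmaps fun c _ _ => prod_nonneg fun i _ => hW _
    _ = ∏ i : Fin m, ∑ c ∈ A, W c :=
        (Finset.prod_univ_sum (fun _ : Fin m => A) (fun _ c => W c)).symm
    _ = _ := by simp [hA]

lemma upper (m t : ℕ) (hm : 0 < m) (h : t * m ^ 2 ≤ 2 ^ t) :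
    (indepCount (treeT m t) (m * t + 2) : ℝ) * (2 ^ t) ^ 2 ≤
      81 * m ^ 2 * 2 ^ (m * t) := by
  have hm' : (1 : ℝ) ≤ m := by exact_mod_cast hm
  have hm0 : (0 : ℝ) < m := by linarith
  set N : ℝ := (indepCount (treeT m t) (m * t + 2) : ℝ)
  have hh : (t : ℝ) * m ^ 2 ≤ 2 ^ t := by exact_mod_cast h
  set x : ℝ := 2 ^ t / m with hxdef
  have hx : 0 < x := by positivity
  have hxm : x * m = 2 ^ t := by rw [hxdef]; field_simp
  have htx : (t : ℝ) * m ≤ x := by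
    rw [hxdef, le_div_iff₀ hm0]; nlinarith
  have ht1 : (t : ℝ) ≤ x := le_trans (le_mul_of_one_le_right (by positivity) hm') htx
  have key := upper_gf m t x hx.le
  have e1 : (1 + x) ^ t ≤ x ^ t * Real.exp 1 := by
    have : 1 + x = x * (1 / x + 1) := by field_simp
    rw [this, mul_pow]
    gcongr
    calc (1 / x + 1) ^ t ≤ (Real.exp (1 / x)) ^ t := by
          gcongr; exact Real.add_one_le_exp _
      _ = Real.exp (t * (1 / x)) := (Real.exp_nat_mul _ _).symm
      _ ≤ _ := by
          apply Real.exp_le_exp.2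
          rw [mul_one_div, div_le_one hx]; exact ht1
  have e2 : (1 + 2 * x) ^ t ≤ (2 * x) ^ t * Real.exp (1 / (2 * m)) := by
    have : 1 + 2 * x = (2 * x) * (1 / (2 * x) + 1) := by field_simp
    rw [this, mul_pow]
    gcongr
    calc (1 / (2 * x) + 1) ^ t ≤ (Real.exp (1 / (2 * x))) ^ t := by
          gcongr; exact Real.add_one_le_exp _
      _ = Real.exp (t * (1 / (2 * x))) := (Real.exp_nat_mul _ _).symm
      _ ≤ _ := by
          apply Real.exp_le_exp.2
          rw [mul_one_div, div_le_div_iff₀ (by positivity) (by positivity)]; nlinarith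
  have e3 : x * (1 + x) ^ t + (1 + 2 * x) ^ t ≤
      (2 * x) ^ t * Real.exp ((Real.exp 1 + 1 / 2) / m) := by
    have a1 : x * (1 + x) ^ t ≤ (2 * x) ^ t * (Real.exp 1 / m) := by
      calc x * (1 + x) ^ t ≤ x * (x ^ t * Real.exp 1) := by gcongr
        _ = _ := by rw [mul_pow, ← hxm]; field_simp
    have a2 : Real.exp 1 / m + Real.exp (1 / (2 * m)) ≤ Real.exp ((Real.exp 1 + 1 / 2) / m) := by
      have : (Real.exp 1 + 1 / 2) / m = Real.exp 1 / m + 1 / (2 * m) := by field_simp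
      rw [this, Real.exp_add]
      have b1 := Real.add_one_le_exp (Real.exp 1 / m)
      have b2 : 1 ≤ Real.exp (1 / (2 * (m : ℝ))) := Real.one_le_exp (by positivity)
      have b3 : 0 ≤ Real.exp 1 / m := by positivity
      nlinarith
    calc _ ≤ (2 * x) ^ t * (Real.exp 1 / m) + (2 * x) ^ t * Real.exp (1 / (2 * m)) :=
          add_le_add a1 e2
      _ = (2 * x) ^ t * (Real.exp 1 / m + Real.exp (1 / (2 * m))) := by ring
      _ ≤ _ := by gcongr
  have e4 : (x * (1 + x) ^ t + (1 + 2 * x) ^ t) ^ m ≤ 2 ^ (m * t) * x ^ (m * t) * 81 := by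
    calc _ ≤ ((2 * x) ^ t * Real.exp ((Real.exp 1 + 1 / 2) / m)) ^ m := by gcongr
      _ = 2 ^ (m * t) * x ^ (m * t) * Real.exp (Real.exp 1 + 1 / 2) := by
          rw [mul_pow, ← pow_mul, ← Real.exp_nat_mul, mul_comm t m, mul_pow]
          congr 2; field_simp
      _ ≤ _ := by
          gcongr
          have := Real.exp_one_lt_d9
          calc Real.exp (Real.exp 1 + 1 / 2) ≤ Real.exp ((4 : ℕ) * 1) := by
                apply Real.exp_le_exp.2; norm_num; linarith
            _ = Real.exp 1 ^ 4 := Real.exp_nat_mul _ _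
            _ ≤ 3 ^ 4 := by gcongr; linarith
            _ = 81 := by norm_num
  have e5 : N * x ^ 2 ≤ 81 * 2 ^ (m * t) := by
    have hp : 0 < x ^ (m * t) := by positivity
    refine le_of_mul_le_mul_right ?_ hp
    calc N * x ^ 2 * x ^ (m * t) = N * x ^ (m * t + 2) := by ring
      _ ≤ _ := key.trans e4
      _ = _ := by ring
  calc N * ((2 : ℝ) ^ t) ^ 2 = (N * x ^ 2) * (m : ℝ) ^ 2 := by rw [← hxm]; ring
    _ ≤ (81 * 2 ^ (m * t)) * (m : ℝ) ^ 2 := by gcongr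
    _ = _ := by ring

/-- For all sufficiently large `t` and every `m` with `t ≤ m ≤ 2^{t/16}`,
log-concavity of the independent set sequence of `T_{m,t,1}` is broken at
`mt+2`. -/
theorem stmt_19 : ∃ T : ℕ, ∀ t : ℕ, T ≤ t → ∀ m : ℕ, t ≤ m →
    (m : ℝ) ≤ (2 : ℝ) ^ ((t : ℝ) / 16) →
    (indepCount (treeT m t) (m * t + 2)) ^ 2 <
      indepCount (treeT m t) (m * t + 1) * indepCount (treeT m t) (m * t + 3) := by
  refine ⟨20, fun t ht m htm hm => ?_⟩
  have h16 : m ^ 16 ≤ 2 ^ t := by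
    have : (m : ℝ) ^ 16 ≤ ((2 : ℝ) ^ ((t : ℝ) / 16)) ^ 16 := by gcongr
    rw [← Real.rpow_natCast, ← Real.rpow_natCast, ← Real.rpow_mul (by norm_num)] at this
    have e : (t : ℝ) / 16 * ((16 : ℕ) : ℝ) = (t : ℝ) := by push_cast; ring
    rw [e, Real.rpow_natCast, Real.rpow_natCast] at this
    exact_mod_cast this
  have hm20 : 20 ≤ m := ht.trans htm
  have h3 : t * m ^ 2 ≤ 2 ^ t := by
    calc t * m ^ 2 ≤ m * m ^ 2 := by gcongr
      _ = m ^ 3 := by ring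
      _ ≤ m ^ 16 := Nat.pow_le_pow_right (by omega) (by norm_num)
      _ ≤ _ := h16
  have h4 : 6561 * m ^ 4 < 2 ^ t := by
    calc 6561 * m ^ 4 < 20 ^ 12 * m ^ 4 := by
          apply Nat.mul_lt_mul_of_pos_right (by norm_num) (by positivity)
      _ ≤ m ^ 12 * m ^ 4 := by gcongr
      _ = m ^ 16 := by ring
      _ ≤ _ := h16
  have hu := upper m t (by omega) h3
  have hu' : indepCount (treeT m t) (m * t + 2) * (2 ^ t) ^ 2 ≤ 81 * m ^ 2 * 2 ^ (m * t) := by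
    exact_mod_cast hu
  have l1 := lower1 m t
  obtain ⟨n, rfl⟩ : ∃ n, m = n + 3 := ⟨m - 3, by omega⟩
  have l3 := lower3 n t
  set a := indepCount (treeT (n+3) t) ((n+3) * t + 1)
  set b := indepCount (treeT (n+3) t) ((n+3) * t + 2)
  set c := indepCount (treeT (n+3) t) ((n+3) * t + 3)
  set M := n + 3
  have hM : 2 ^ (M * t) = 2 ^ (n * t) * (2 ^ t) ^ 3 := by
    rw [← pow_mul, ← pow_add]; congr 1; simp only [M]; ring
  set P := 2 ^ t
  have hP : 0 < P := by positivity
  set Q := 2 ^ (n * t)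
  have hQ : 0 < Q := by positivity
  have hb : b ≤ 81 * M ^ 2 * Q * P := by
    rw [hM] at hu'
    refine Nat.le_of_mul_le_mul_right ?_ (show 0 < P ^ 2 by positivity)
    calc b * P ^ 2 ≤ _ := hu'
      _ = _ := by ring
  calc b ^ 2 ≤ (81 * M ^ 2 * Q * P) ^ 2 := by gcongr
    _ = (6561 * M ^ 4) * (Q ^ 2 * P ^ 2) := by ring
    _ < P * (Q ^ 2 * P ^ 2) := Nat.mul_lt_mul_of_pos_right h4 (by positivity)
    _ = (Q * P ^ 3) * Q := by ring
    _ ≤ a * c := by rw [hM] at l1; gcongr
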